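/- Let 0 < α < 1 and let n ≥ 3 be an integer. Define W_n[α] = Σ_{k=1}^{n−1} k^{−α} − n^{1−α}/(1−α) − ζ(α). Then the weight σ_{n−1} = −(n−2)^{−α} − 2 W_n[α] satisfies σ_{n−1} < −11α/(6 n^{1+α}). -/

import Mathlib

/-- Real values of the Riemann zeta function at real arguments
(real part of the analytic continuation). -/
noncomputable def zr (s : ℝ) : ℝ := (riemannZeta s).re

/-- `W_n[α] = Σ_{k=1}^{n−1} k^{−α} − n^{1−α}/(1−α) − ζ(α)`. -/
noncomputable def W (n : ℕ) (α : ℝ) : ℝ :=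
  (∑ k ∈ Finset.Icc 1 (n - 1), (k:ℝ) ^ (-α)) - (n:ℝ) ^ (1 - α) / (1 - α) - zr α

open Filter Topology

theorem hasDerivAt_ofReal_cpow_of_pos (r : ℂ) {x : ℝ} (hx : 0 < x) :
    HasDerivAt (fun y : ℝ => (y : ℂ) ^ r) (r * (x : ℂ) ^ (r - 1)) x := by
  have h : ((x : ℂ)) ∈ Complex.slitPlane := by simp [Complex.mem_slitPlane_iff, hx]
  simpa using ((hasDerivAt_id (x : ℂ)).cpow_const (c := r) h).comp_ofReal

theorem norm_cpow_neg_sub_le {s : ℂ} (hs : 0 < s.re) {a x : ℝ} (ha : 0 < a) (hx : a ≤ x) :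
    ‖(x : ℂ) ^ (-s) - (a : ℂ) ^ (-s)‖ ≤ ‖s‖ * a ^ (-s.re - 1) * (x - a) := by
  refine norm_image_sub_le_of_norm_deriv_le_segment' (b := x)
    (fun y hy => (hasDerivAt_ofReal_cpow_of_pos (-s) (ha.trans_le hy.1)).hasDerivWithinAt)
    (fun y hy => ?_) x ⟨hx, le_rfl⟩
  rw [norm_mul, norm_neg, Complex.norm_cpow_eq_rpow_re_of_pos (ha.trans_le hy.1)]
  gcongr ‖s‖ * ?_
  simpa using Real.rpow_le_rpow_of_nonpos ha hy.1 (by linarith)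

/-- `(1 - s) * (a ^ (-s) - ∫ x in a..a+1, x ^ (-s))`, written without the integral. -/
noncomputable def zetaTerm (a : ℝ) (s : ℂ) : ℂ :=
  (1 - s) * (a : ℂ) ^ (-s) - (((a + 1 : ℝ) : ℂ) ^ (1 - s) - (a : ℂ) ^ (1 - s))

theorem norm_zetaTerm_le {s : ℂ} (hs : 0 < s.re) {a : ℝ} (ha : 0 < a) :
    ‖zetaTerm a s‖ ≤ ‖1 - s‖ * (‖s‖ * a ^ (-s.re - 1)) := by
  have hd : ∀ y ∈ Set.Icc a (a + 1), HasDerivWithinAt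
      (fun y : ℝ => (1 - s) * (a : ℂ) ^ (-s) * (y : ℂ) - (y : ℂ) ^ (1 - s))
      ((1 - s) * (a : ℂ) ^ (-s) * 1 - (1 - s) * (y : ℂ) ^ (1 - s - 1)) (Set.Icc a (a + 1)) y := by
    intro y hy
    exact (((hasDerivAt_id (y : ℂ)).comp_ofReal.const_mul _).sub
      (hasDerivAt_ofReal_cpow_of_pos _ (ha.trans_le hy.1))).hasDerivWithinAt
  have key := norm_image_sub_le_of_norm_deriv_le_segment'
    (C := ‖1 - s‖ * (‖s‖ * a ^ (-s.re - 1))) hd (fun y hy => ?_) (a + 1) ⟨by linarith, le_rfl⟩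
  · have e : zetaTerm a s =
        (1 - s) * (a : ℂ) ^ (-s) * ((a + 1 : ℝ) : ℂ) - ((a + 1 : ℝ) : ℂ) ^ (1 - s)
        - ((1 - s) * (a : ℂ) ^ (-s) * (a : ℂ) - (a : ℂ) ^ (1 - s)) := by
      unfold zetaTerm; push_cast; ring
    rw [e]
    simpa using key
  · have e : (1 - s) * (a : ℂ) ^ (-s) * 1 - (1 - s) * (y : ℂ) ^ (1 - s - 1)
        = -((1 - s) * ((y : ℂ) ^ (-s) - (a : ℂ) ^ (-s))) := by
      rw [show 1 - s - 1 = -s by ring]; ring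
    rw [e, norm_neg, norm_mul]
    gcongr
    refine (norm_cpow_neg_sub_le hs ha hy.1).trans ?_
    have : y - a ≤ 1 := by linarith [hy.2]
    exact mul_le_of_le_one_right (by positivity) this

theorem summable_add_one_rpow {σ : ℝ} (hσ : 0 < σ) :
    Summable fun n : ℕ => ((n : ℝ) + 1) ^ (-σ - 1) := by
  simpa using (summable_nat_add_iff 1).2
    (Real.summable_nat_rpow (p := -σ - 1).2 (by linarith))

theorem summable_zetaTerm {s : ℂ} (hs : 0 < s.re) :
    Summable fun n : ℕ => zetaTerm (n + 1) s :=
  Summable.of_norm_bounded (((summable_add_one_rpow hs).mul_left ‖s‖).mul_left ‖1 - s‖)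
    fun n => norm_zetaTerm_le hs (by positivity)

theorem sum_zetaTerm (N : ℕ) {s : ℂ} :
    ∑ k ∈ Finset.range N, zetaTerm (k + 1) s =
      (1 - s) * ∑ k ∈ Finset.range N, ((k : ℂ) + 1) ^ (-s) - ((N : ℂ) + 1) ^ (1 - s) + 1 := by
  induction N with
  | zero => simp
  | succ N ih =>
    rw [Finset.sum_range_succ, Finset.sum_range_succ, ih, zetaTerm]
    push_cast
    ring

theorem tsum_zetaTerm_of_one_lt_re {s : ℂ} (hs : 1 < s.re) :
    ∑' n : ℕ, zetaTerm (n + 1) s = 1 - riemannZeta₁ s := by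
  have hs1 : s ≠ 1 := by rintro rfl; simp at hs
  have h1 := (summable_zetaTerm (zero_lt_one.trans hs)).hasSum.tendsto_sum_nat
  have hsum : Summable fun n : ℕ => ((n : ℂ) + 1) ^ (-s) := by
    have := (summable_nat_add_iff 1).2 (Complex.summable_one_div_nat_cpow.2 hs)
    simpa [Complex.cpow_neg] using this
  have h2 := hsum.hasSum.tendsto_sum_nat
  have hz : ∑' n : ℕ, ((n : ℂ) + 1) ^ (-s) = riemannZeta s := by
    rw [zeta_eq_tsum_one_div_nat_add_one_cpow hs]
    simp [Complex.cpow_neg]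
  have h3 : Tendsto (fun N : ℕ => ((N : ℂ) + 1) ^ (1 - s)) atTop (𝓝 0) := by
    rw [tendsto_zero_iff_norm_tendsto_zero]
    have h := (tendsto_rpow_neg_atTop (y := s.re - 1) (by linarith)).comp
      (tendsto_atTop_add_const_right atTop (1 : ℝ) tendsto_natCast_atTop_atTop)
    refine h.congr fun N => ?_
    have : ((N : ℂ) + 1) = ((N + 1 : ℝ) : ℂ) := by push_cast; rfl
    rw [this, Complex.norm_cpow_eq_rpow_re_of_pos (by positivity)]
    simp
  have h4 := ((h2.const_mul (1 - s)).sub h3).add_const 1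
  simp_rw [sum_zetaTerm] at h1
  rw [tendsto_nhds_unique h1 h4, hz, riemannZeta_eq_inv_sub_mul hs1]
  have : s - 1 ≠ 0 := sub_ne_zero.2 hs1
  field_simp
  ring

theorem differentiable_zetaTerm {a : ℝ} (ha : 0 < a) : Differentiable ℂ (zetaTerm a) := by
  have h1 : (a : ℂ) ≠ 0 := by exact_mod_cast ha.ne'
  have h2 : ((a + 1 : ℝ) : ℂ) ≠ 0 := by exact_mod_cast (by positivity : (0 : ℝ) < a + 1).ne'
  unfold zetaTerm
  intro s
  have e1 : DifferentiableAt ℂ (fun s : ℂ => (a : ℂ) ^ (-s)) s :=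
    (by fun_prop : DifferentiableAt ℂ (fun s : ℂ => -s) s).const_cpow (Or.inl h1)
  have e2 : DifferentiableAt ℂ (fun s : ℂ => (a : ℂ) ^ (1 - s)) s :=
    (by fun_prop : DifferentiableAt ℂ (fun s : ℂ => 1 - s) s).const_cpow (Or.inl h1)
  have e3 : DifferentiableAt ℂ (fun s : ℂ => ((a + 1 : ℝ) : ℂ) ^ (1 - s)) s :=
    (by fun_prop : DifferentiableAt ℂ (fun s : ℂ => 1 - s) s).const_cpow (Or.inl h2)
  exact ((by fun_prop : DifferentiableAt ℂ (fun s : ℂ => 1 - s) s).mul e1).sub (e3.sub e2)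

theorem tsum_zetaTerm {s : ℂ} (hs : 0 < s.re) :
    ∑' n : ℕ, zetaTerm (n + 1) s = 1 - riemannZeta₁ s := by
  set σ := min (s.re / 2) 1 with hσ
  have hσ0 : 0 < σ := by positivity
  set R := ‖s‖ + 3 with hR
  set U : Set ℂ := {c : ℂ | σ < c.re} ∩ Metric.ball 0 R with hU
  have hUo : IsOpen U := (isOpen_lt continuous_const Complex.continuous_re).inter Metric.isOpen_ball
  have hUc : IsPreconnected U :=
    ((convex_halfSpace_re_gt σ).inter (convex_ball 0 R)).isPreconnected
  have hsU : s ∈ U := by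
    refine ⟨(min_le_left _ _).trans_lt (half_lt_self hs), ?_⟩
    rw [mem_ball_zero_iff, hR]; linarith
  have h2U : (2 : ℂ) ∈ U := by
    refine ⟨(min_le_right _ _).trans_lt (show (1 : ℝ) < (2 : ℂ).re by simp), ?_⟩
    rw [mem_ball_zero_iff, hR, Complex.norm_ofNat]; linarith [norm_nonneg s]
  have hbound : ∀ (n : ℕ) (w : ℂ), w ∈ U →
      ‖zetaTerm (n + 1) w‖ ≤ (1 + R) * (R * ((n : ℝ) + 1) ^ (-σ - 1)) := by
    intro n w hw
    have hw1 : σ < w.re := hw.1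
    have hw2 : ‖w‖ ≤ R := (mem_ball_zero_iff.1 hw.2).le
    have hR0 : 0 ≤ R := (norm_nonneg w).trans hw2
    refine (norm_zetaTerm_le (hσ0.trans hw1) (by positivity)).trans ?_
    gcongr
    · exact (norm_sub_le _ _).trans (by simpa using hw2)
    · linarith [n.cast_nonneg (α := ℝ)]
  have hd : DifferentiableOn ℂ (fun w : ℂ => ∑' n : ℕ, zetaTerm (n + 1) w) U :=
    Complex.differentiableOn_tsum_of_summable_norm
      (((summable_add_one_rpow hσ0).mul_left R).mul_left (1 + R))
      (fun n => (differentiable_zetaTerm (by positivity)).differentiableOn) hUo hbound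
  have hd' : DifferentiableOn ℂ (fun w : ℂ => 1 - riemannZeta₁ w) U := by fun_prop
  refine (hd.analyticOnNhd hUo).eqOn_of_preconnected_of_eventuallyEq (hd'.analyticOnNhd hUo)
    hUc h2U ?_ hsU
  filter_upwards [(isOpen_lt continuous_const Complex.continuous_re).mem_nhds
    (show (1 : ℝ) < (2 : ℂ).re by simp)] with w hw
  exact tsum_zetaTerm_of_one_lt_re hw

/-- On `0 < re s`, `s ≠ 1`, the zeta function is the limit of its partial sums corrected by the
divergent main term. -/
theorem tendsto_sum_cpow_sub_riemannZeta {s : ℂ} (hs : 0 < s.re) (hs1 : s ≠ 1) :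
    Tendsto (fun N : ℕ => ∑ k ∈ Finset.range N, ((k : ℂ) + 1) ^ (-s)
      - ((N : ℂ) + 1) ^ (1 - s) / (1 - s)) atTop (𝓝 (riemannZeta s)) := by
  have h := (summable_zetaTerm hs).hasSum.tendsto_sum_nat
  rw [tsum_zetaTerm hs] at h
  have hne : 1 - s ≠ 0 := sub_ne_zero.2 hs1.symm
  have hne' : s - 1 ≠ 0 := sub_ne_zero.2 hs1
  have h' := (h.sub_const 1).div_const (1 - s)
  have e : (1 - riemannZeta₁ s - 1) / (1 - s) = riemannZeta s := by
    rw [riemannZeta_eq_inv_sub_mul hs1]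
    field_simp
    ring
  rw [e] at h'
  refine h'.congr fun N => ?_
  rw [sum_zetaTerm]
  field_simp
  ring

theorem W_succ (n : ℕ) (α : ℝ) :
    W (n + 1) α = ∑ k ∈ Finset.range n, ((k : ℝ) + 1) ^ (-α)
      - ((n : ℝ) + 1) ^ (1 - α) / (1 - α) - zr α := by
  have : ∑ k ∈ Finset.Icc 1 n, (k : ℝ) ^ (-α) = ∑ k ∈ Finset.range n, ((k : ℝ) + 1) ^ (-α) := by
    rw [Finset.range_eq_Ico, ← Finset.Ico_add_one_right_eq_Icc,
      ← Finset.sum_Ico_add' (fun k : ℕ => (k : ℝ) ^ (-α)) 0 n 1]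
    simp
  simp [W, this]

theorem tendsto_W {α : ℝ} (hα0 : 0 < α) (hα1 : α < 1) :
    Tendsto (fun n : ℕ => W (n + 1) α) atTop (𝓝 0) := by
  have h := tendsto_sum_cpow_sub_riemannZeta (s := (α : ℂ)) (by simpa using hα0)
    (by exact_mod_cast hα1.ne)
  have h' := ((Complex.continuous_re.tendsto _).comp h).sub_const (zr α)
  rw [zr, sub_self] at h'
  refine h'.congr fun n => ?_
  rw [W_succ, ← zr]
  congr 1
  have hr : (∑ k ∈ Finset.range n, ((k : ℂ) + 1) ^ (-(α : ℂ))
      - ((n : ℂ) + 1) ^ (1 - (α : ℂ)) / (1 - (α : ℂ))) =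
      ((∑ k ∈ Finset.range n, ((k : ℝ) + 1) ^ (-α)
      - ((n : ℝ) + 1) ^ (1 - α) / (1 - α) : ℝ) : ℂ) := by
    push_cast [Complex.ofReal_cpow (by positivity : (0 : ℝ) ≤ (n : ℝ) + 1)]
    congr 1
    refine Finset.sum_congr rfl fun k _ => ?_
    rw [Complex.ofReal_cpow (by positivity)]
    push_cast
    rfl
  rw [Function.comp_apply, hr, Complex.ofReal_re]

theorem nonpos_of_hasDerivAt_nonpos {g g' : ℝ → ℝ} {a : ℝ} (ha : g a = 0)
    (hg : ∀ x, a ≤ x → HasDerivAt g (g' x) x) (hg' : ∀ x, a ≤ x → g' x ≤ 0) :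
    ∀ x, a ≤ x → g x ≤ 0 := by
  intro x hx
  rw [← ha]
  refine antitoneOn_of_deriv_nonpos (convex_Ici a)
    (fun y hy => (hg y hy).continuousAt.continuousWithinAt)
    (fun y hy => (hg y (interior_subset hy)).differentiableAt.differentiableWithinAt)
    (fun y hy => ?_) Set.self_mem_Ici hx hx
  rw [(hg y (interior_subset hy)).deriv]
  exact hg' y (interior_subset hy)

/-- The trapezoidal rule with its first Euler–Maclaurin correction underestimates the integral of
a function with nonnegative fourth derivative. -/
theorem corrected_trapezoid_le {F f f₁ f₂ f₃ f₄ : ℝ → ℝ} {a : ℝ}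
    (hF : ∀ x, a ≤ x → HasDerivAt F (f x) x) (hf : ∀ x, a ≤ x → HasDerivAt f (f₁ x) x)
    (hf₁ : ∀ x, a ≤ x → HasDerivAt f₁ (f₂ x) x) (hf₂ : ∀ x, a ≤ x → HasDerivAt f₂ (f₃ x) x)
    (hf₃ : ∀ x, a ≤ x → HasDerivAt f₃ (f₄ x) x) (hf₄ : ∀ x, a ≤ x → 0 ≤ f₄ x)
    {x : ℝ} (hx : a ≤ x) :
    (x - a) / 2 * (f a + f x) - (x - a) ^ 2 / 12 * (f₁ x - f₁ a) ≤ F x - F a := by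
  have hs (x : ℝ) : HasDerivAt (fun x => x - a) 1 x := (hasDerivAt_id x).sub_const a
  have h2 := nonpos_of_hasDerivAt_nonpos (a := a)
    (g := fun x => (f₁ a - f₁ x) / 6 + (x - a) / 6 * f₂ x - (x - a) ^ 2 / 12 * f₃ x)
    (g' := fun x => -((x - a) ^ 2 / 12 * f₄ x)) (by simp)
    (fun x hx => (((((hf₁ x hx).const_sub (f₁ a)).div_const 6).add
        (((hs x).div_const 6).mul (hf₂ x hx))).sub
        ((((hs x).pow 2).div_const 12).mul (hf₃ x hx))).congr_deriv (by dsimp; ring))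
    (fun x hx => neg_nonpos.2 (mul_nonneg (by positivity) (hf₄ x hx)))
  have h1 := nonpos_of_hasDerivAt_nonpos (a := a)
    (g := fun x => (f a - f x) / 2 + (x - a) / 3 * f₁ x + (x - a) / 6 * f₁ a
      - (x - a) ^ 2 / 12 * f₂ x) (by simp)
    (fun x hx => ((((((hf x hx).const_sub (f a)).div_const 2).add
        (((hs x).div_const 3).mul (hf₁ x hx))).add (((hs x).div_const 6).mul_const (f₁ a))).sub
        ((((hs x).pow 2).div_const 12).mul (hf₂ x hx))).congr_deriv (by dsimp; ring)) h2
  have h0 := nonpos_of_hasDerivAt_nonpos (a := a)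
    (g := fun x => (x - a) / 2 * (f a + f x) - (F x - F a)
      - (x - a) ^ 2 / 12 * (f₁ x - f₁ a)) (by simp)
    (fun x hx => (((((hs x).div_const 2).mul ((hf x hx).const_add (f a))).sub
        ((hF x hx).sub_const (F a))).sub
        ((((hs x).pow 2).div_const 12).mul ((hf₁ x hx).sub_const (f₁ a)))).congr_deriv
        (by dsimp; ring)) h1 x hx
  linarith

theorem corrected_trapezoid_rpow_le {α a : ℝ} (hα0 : 0 < α) (hα1 : α < 1) (ha : 0 < a) :
    (a ^ (-α) + (a + 1) ^ (-α)) / 2 + α / 12 * ((a + 1) ^ (-α - 1) - a ^ (-α - 1)) ≤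
      ((a + 1) ^ (1 - α) - a ^ (1 - α)) / (1 - α) := by
  have hd (c p : ℝ) (x : ℝ) (hx : a ≤ x) :
      HasDerivAt (fun y : ℝ => c * y ^ p) (c * p * x ^ (p - 1)) x := by
    rw [mul_assoc]
    exact (Real.hasDerivAt_rpow_const (Or.inl (ha.trans_le hx).ne')).const_mul c
  have hne : 1 - α ≠ 0 := by linarith
  have h := corrected_trapezoid_le (a := a) (f := fun x => x ^ (-α)) (f₁ := fun x => -α * x ^ (-α - 1))
    (fun x hx => by
      have := hd (1 / (1 - α)) (1 - α) x hx
      rwa [one_div_mul_cancel hne, one_mul, show 1 - α - 1 = -α by ring] at this)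
    (fun x hx => by simpa using hd 1 (-α) x hx)
    (hd _ _) (hd (-α * (-α - 1)) (-α - 1 - 1)) (hd (-α * (-α - 1) * (-α - 1 - 1)) (-α - 1 - 1 - 1))
    (fun x hx => mul_nonneg (by
      have : 0 ≤ α * (α + 1) * (α + 2) * (α + 3) := by positivity
      linarith) (Real.rpow_nonneg (ha.le.trans hx) _))
    (show a ≤ a + 1 by linarith)
  have e : ((a + 1) ^ (1 - α) - a ^ (1 - α)) / (1 - α) =
      1 / (1 - α) * (a + 1) ^ (1 - α) - 1 / (1 - α) * a ^ (1 - α) := by ring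
  rw [e]
  refine le_trans (le_of_eq ?_) h
  ring

theorem W_lower_bound {α : ℝ} (hα0 : 0 < α) (hα1 : α < 1) (n : ℕ) :
    0 ≤ W (n + 1) α + ((n : ℝ) + 1) ^ (-α) / 2 + α / 12 * ((n : ℝ) + 1) ^ (-α - 1) := by
  have hanti : Antitone fun n : ℕ =>
      W (n + 1) α + ((n : ℝ) + 1) ^ (-α) / 2 + α / 12 * ((n : ℝ) + 1) ^ (-α - 1) := by
    refine antitone_nat_of_succ_le fun n => ?_
    have h := corrected_trapezoid_rpow_le hα0 hα1 (by positivity : (0 : ℝ) < (n : ℝ) + 1)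
    rw [W_succ (n + 1), W_succ n, Finset.sum_range_succ]
    push_cast
    rw [sub_div] at h
    linarith
  refine hanti.le_of_tendsto ?_ n
  have hp {p : ℝ} (hp : 0 < p) : Tendsto (fun n : ℕ => ((n : ℝ) + 1) ^ (-p)) atTop (𝓝 0) :=
    (tendsto_rpow_neg_atTop hp).comp
      (tendsto_atTop_add_const_right atTop (1 : ℝ) tendsto_natCast_atTop_atTop)
  have h := ((tendsto_W hα0 hα1).add ((hp hα0).div_const 2)).add
    ((hp (by linarith : 0 < α + 1)).const_mul (α / 12))
  simpa [sub_eq_add_neg, add_comm] using h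

theorem rpow_neg_add_lt_sub_two_rpow_neg {α x : ℝ} (hα0 : 0 < α) (hα1 : α < 1) (hx : 2 < x) :
    x ^ (-α) + 2 * α * x ^ (-α - 1) < (x - 2) ^ (-α) := by
  have hx0 : 0 < x := by linarith
  have h2 : 2 / x < 1 := (div_lt_one hx0).2 hx
  have hb := rpow_one_add_lt_one_add_mul_self (s := -(2 / x)) (by linarith)
    (by simpa using hx0.ne') hα0 hα1
  have hpos : 0 < 1 + -(2 / x) := by linarith
  have hppos := Real.rpow_pos_of_pos hpos α
  have hinv : 1 + α * (2 / x) < (1 + -(2 / x)) ^ (-α) := by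
    rw [Real.rpow_neg hpos.le, lt_inv_comm₀ (by positivity) hppos]
    refine hb.trans_le ?_
    rw [le_inv_comm₀ (by linarith) (by positivity), ← one_div, le_div_iff₀ (by linarith)]
    nlinarith [sq_nonneg (α * (2 / x))]
  have e : x - 2 = x * (1 + -(2 / x)) := by field_simp; ring
  rw [e, Real.mul_rpow hx0.le hpos.le, Real.rpow_sub_one hx0.ne']
  have := mul_lt_mul_of_pos_left hinv (Real.rpow_pos_of_pos hx0 (-α))
  refine lt_of_eq_of_lt ?_ this
  ring

theorem weight_nsub1_bound
    (α : ℝ) (hα0 : 0 < α) (hα1 : α < 1) (n : ℕ) (hn : 3 ≤ n) :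
    -(((n:ℝ) - 2) ^ (-α)) - 2 * W n α < -(11 * α) / (6 * (n:ℝ) ^ (1 + α)) := by
  have hn3 : (3 : ℝ) ≤ n := by exact_mod_cast hn
  have hW := W_lower_bound hα0 hα1 (n - 1)
  rw [Nat.sub_add_cancel (by lia), Nat.cast_sub (by lia), Nat.cast_one, sub_add_cancel] at hW
  have hB := rpow_neg_add_lt_sub_two_rpow_neg hα0 hα1 (by linarith : (2 : ℝ) < n)
  have e : -(11 * α) / (6 * (n : ℝ) ^ (1 + α)) = -(11 * α / 6) * (n : ℝ) ^ (-α - 1) := by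
    rw [show -α - 1 = -(1 + α) by ring, Real.rpow_neg (by linarith)]
    field_simp
  rw [e]
  linarith
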